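/- The product of the pong algebra is associative: for all a, b, c ∈ P(m, k), μ₂(μ₂(a, b), c) = μ₂(a, μ₂(b, c)). -/

import Mathlib

open scoped Classical BigOperators

noncomputable section

/-- The group `G_m` of bijections of `ℤ` generated by the reflections
`x ↦ 1 - x` (about `1/2`) and `x ↦ 2m - 1 - x` (about `m - 1/2`). -/
def Gm (m : ℕ) : Subgroup (Equiv.Perm ℤ) :=
  Subgroup.closure {Equiv.subLeft (1 : ℤ), Equiv.subLeft (2 * (m : ℤ) - 1)}

/-- `y` lies in the `G_m`-orbit of `x`. -/
def GmRel (m : ℕ) (x y : ℤ) : Prop := ∃ g ∈ Gm m, g x = y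

/-- The `G_m`-orbit of an integer. -/
def GmOrbit (m : ℕ) (x : ℤ) : Set ℤ := {y | GmRel m x y}

/-- `(S, f)` is a lifted partial permutation on `k` letters: `S` is a
`G_m`-invariant subset of `ℤ`, `f` is `G_m`-equivariant on `S`, the quotient
`S/G_m` has exactly `k` elements, and the induced map `S/G_m → ℤ/G_m` is
injective.  (The values of `f` off `S` are irrelevant.) -/
structure IsLPP (m k : ℕ) (S : Set ℤ) (f : ℤ → ℤ) : Prop where
  invariant : ∀ g ∈ Gm m, ∀ x ∈ S, g x ∈ S
  equivariant : ∀ g ∈ Gm m, ∀ x ∈ S, f (g x) = g (f x)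
  orbits : (GmOrbit m '' S).ncard = k
  inj : ∀ x ∈ S, ∀ y ∈ S, GmRel m (f x) (f y) → GmRel m x y

/-- `(i, j)` is a crossing pair for `(S, f)`. -/
def IsCrossing (S : Set ℤ) (f : ℤ → ℤ) (i j : ℤ) : Prop :=
  i ∈ S ∧ j ∈ S ∧ i < j ∧ f j < f i

/-- The `G_m`-orbit of the unordered pair `{p.1, p.2}`; two pairs are
equivalent exactly when they have the same `pairOrbit`. -/
def pairOrbit (m : ℕ) (p : ℤ × ℤ) : Set (Set ℤ) :=
  {A | ∃ g ∈ Gm m, A = {g p.1, g p.2}}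

/-- The set of crossings of `(S, f)` (equivalence classes of crossing pairs). -/
def crossings (m : ℕ) (S : Set ℤ) (f : ℤ → ℤ) : Set (Set (Set ℤ)) :=
  pairOrbit m '' {p : ℤ × ℤ | IsCrossing S f p.1 p.2}

/-- The number of crossings `cross(f)`. -/
def crossCount (m : ℕ) (S : Set ℤ) (f : ℤ → ℤ) : ℕ := (crossings m S f).ncard

/-- The set whose cardinality (halved) is the weight `w_j(S, f)`. -/
def weightSet (j : ℤ) (S : Set ℤ) (f : ℤ → ℤ) : Set ℤ :=
  {i | i ∈ S ∧ (((i : ℚ) < (j : ℚ) - 1/2 ∧ (j : ℚ) - 1/2 < (f i : ℚ)) ∨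
    ((f i : ℚ) < (j : ℚ) - 1/2 ∧ (j : ℚ) - 1/2 < (i : ℚ)))}

/-- The weight `w_j(S, f)`. -/
def weight (j : ℤ) (S : Set ℤ) (f : ℤ → ℤ) : ℚ := (weightSet j S f).ncard / 2

/-- The resolution `f_{⟨i,j⟩}` of `f` at the crossing `⟨i, j⟩`. -/
def resolveFun (m : ℕ) (f : ℤ → ℤ) (i j : ℤ) : ℤ → ℤ := fun x =>
  if h : ∃ g ∈ Gm m, g i = x then h.choose (f j)
  else if h' : ∃ g ∈ Gm m, g j = x then h'.choose (f i)
  else f x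

/-- The graph `Γ_f = {(i, f i) : i ∈ S}`. -/
def graphOf (S : Set ℤ) (f : ℤ → ℤ) : Set (ℤ × ℤ) :=
  {p | p.1 ∈ S ∧ p.2 = f p.1}

/-- The `G_m`-orbit of a point of `ℤ × ℤ` under the diagonal action. -/
def GmOrbit2 (m : ℕ) (p : ℤ × ℤ) : Set (ℤ × ℤ) :=
  {q | ∃ g ∈ Gm m, (g p.1, g p.2) = q}

/-- The left endpoint of the image of the unit interval `[a, a+1]` under the
affine extension of `g` to `ℝ`. -/
def sqIdx (g : Equiv.Perm ℤ) (a : ℤ) : ℤ := min (g a) (g (a + 1))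

/-- The `G_m`-orbit of it the unit square indexed by `p`. -/
def sqOrbit (m : ℕ) (p : ℤ × ℤ) : Set (ℤ × ℤ) :=
  {q | ∃ g ∈ Gm m, (sqIdx g p.1, sqIdx g p.2) = q}

/-- `D` is a domain from `(S, f)` to `(T, g)`: a `G_m`-invariant assignment of
multiplicities to unit squares, nonzero on finitely many `G_m`-orbits of
squares, whose corners are governed by the two graphs. -/
def IsHDomain (m : ℕ) (S : Set ℤ) (f : ℤ → ℤ) (T : Set ℤ) (g : ℤ → ℤ)
    (D : ℤ × ℤ → ℤ) : Prop :=
  (∀ γ ∈ Gm m, ∀ a b : ℤ, D (sqIdx γ a, sqIdx γ b) = D (a, b)) ∧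
  (sqOrbit m '' {p : ℤ × ℤ | D p ≠ 0}).Finite ∧
  (∀ i j : ℤ,
    D (i, j) + D (i - 1, j - 1) - D (i, j - 1) - D (i - 1, j) =
      (if (i, j) ∈ graphOf T g then 1 else 0) -
        (if (i, j) ∈ graphOf S f then 1 else 0))

/-- The basis of the pong algebra: lifted partial permutations, normalized to
be the identity off their domain (so that each lifted partial permutation is
represented by exactly one basis element). -/
def PongIdx (m k : ℕ) : Type :=
  {P : Set ℤ × (ℤ → ℤ) // IsLPP m k P.1 P.2 ∧ ∀ x ∉ P.1, P.2 x = x}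

/-- The ground ring `F₂[v₁, …, v_m]` of the pong algebra. -/
abbrev PongRing (m : ℕ) := MvPolynomial (Fin m) (ZMod 2)

/-- The exponent vector `(w_l(f) - w_l(f'))_{l=1}^m` appearing in the
differential of the pong algebra. -/
def expDiff (m : ℕ) (S : Set ℤ) (f f' : ℤ → ℤ) : Fin m →₀ ℕ :=
  Finsupp.equivFunOnFinite.symm fun l =>
    ((weightSet (((l : ℕ) : ℤ) + 1) S f).ncard
      - (weightSet (((l : ℕ) : ℤ) + 1) S f').ncard) / 2

/-- The exponent vector `(w_l(f) + w_l(g) - w_l(g ∘ f))_{l=1}^m` appearing in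
the product of the pong algebra. -/
def expMul (m : ℕ) (S T : Set ℤ) (f g : ℤ → ℤ) : Fin m →₀ ℕ :=
  Finsupp.equivFunOnFinite.symm fun l =>
    ((weightSet (((l : ℕ) : ℤ) + 1) S f).ncard
      + (weightSet (((l : ℕ) : ℤ) + 1) T g).ncard
      - (weightSet (((l : ℕ) : ℤ) + 1) S (g ∘ f)).ncard) / 2

/-- The set of crossings of `(S, f)` whose resolution drops the crossing
number by exactly one and yields the function `f'` (on `S`). -/
def resCrossSet (m : ℕ) (S : Set ℤ) (f f' : ℤ → ℤ) : Set (Set (Set ℤ)) :=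
  pairOrbit m '' {p : ℤ × ℤ | IsCrossing S f p.1 p.2 ∧
    Set.EqOn (resolveFun m f p.1 p.2) f' S ∧
    crossCount m S (resolveFun m f p.1 p.2) + 1 = crossCount m S f}

/-- The structure constants of the differential `∂` of the pong algebra:
`∂ (S, f) = Σ_q Mdiff((S,f), q) · q`. -/
def Mdiff (m k : ℕ) (p q : PongIdx m k) : PongRing m :=
  if q.1.1 = p.1.1 then
    MvPolynomial.monomial (expDiff m p.1.1 p.1.2 q.1.2)
      ((resCrossSet m p.1.1 p.1.2 q.1.2).ncard : ZMod 2)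
  else 0

/-- The structure constants of the product `μ₂` of the pong algebra:
`μ₂(p, q) = Σ_s Mmul(p, q, s) · s`. -/
def Mmul (m k : ℕ) (p q s : PongIdx m k) : PongRing m :=
  if q.1.1 = p.1.2 '' p.1.1 ∧
      crossCount m p.1.1 (q.1.2 ∘ p.1.2)
        = crossCount m p.1.1 p.1.2 + crossCount m q.1.1 q.1.2 ∧
      s.1.1 = p.1.1 ∧ Set.EqOn s.1.2 (q.1.2 ∘ p.1.2) p.1.1
  then MvPolynomial.monomial (expMul m p.1.1 q.1.1 p.1.2 q.1.2) 1
  else 0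


/-- Every element of `G_m` is a translation by, or a reflection up to, a multiple of `2m - 2`. -/
theorem Gm_apply_eq {m : ℕ} {g : Equiv.Perm ℤ} (hg : g ∈ Gm m) :
    (∃ n : ℤ, ∀ x, g x = x + n * (2 * m - 2)) ∨
      (∃ n : ℤ, ∀ x, g x = 1 - x + n * (2 * m - 2)) := by
  unfold Gm at hg
  induction hg using Subgroup.closure_induction with
  | mem g hg =>
    rcases hg with rfl | rfl
    · exact Or.inr ⟨0, fun x => by simp⟩
    · exact Or.inr ⟨1, fun x => by simp; ring⟩
  | one => exact Or.inl ⟨0, fun x => by simp⟩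
  | mul g h _ _ ihg ihh =>
    rcases ihg with ⟨a, ha⟩ | ⟨a, ha⟩ <;> rcases ihh with ⟨b, hb⟩ | ⟨b, hb⟩
    · exact Or.inl ⟨b + a, fun x => by rw [Equiv.Perm.mul_apply, ha, hb]; ring⟩
    · exact Or.inr ⟨b + a, fun x => by rw [Equiv.Perm.mul_apply, ha, hb]; ring⟩
    · exact Or.inr ⟨a - b, fun x => by rw [Equiv.Perm.mul_apply, ha, hb]; ring⟩
    · exact Or.inl ⟨a - b, fun x => by rw [Equiv.Perm.mul_apply, ha, hb]; ring⟩
  | inv g _ ih =>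
    rcases ih with ⟨a, ha⟩ | ⟨a, ha⟩
    · exact Or.inl ⟨-a, fun x => by rw [Equiv.Perm.inv_eq_iff_eq, ha]; ring⟩
    · exact Or.inr ⟨a, fun x => by rw [Equiv.Perm.inv_eq_iff_eq, ha]; ring⟩

/-- `G_m` acts freely on `ℤ`. -/
theorem Gm_apply_eq_self {m : ℕ} {g : Equiv.Perm ℤ} (hg : g ∈ Gm m) {y : ℤ} (h : g y = y)
    (x : ℤ) : g x = x := by
  rcases Gm_apply_eq hg with ⟨n, hn⟩ | ⟨n, hn⟩
  · rw [hn] at h ⊢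
    linarith
  · rw [hn, show n * (2 * (m : ℤ) - 2) = 2 * (n * (m - 1)) by ring] at h
    omega

/-- `G_m` contains all translations by multiples of `2m - 2`. -/
theorem exists_translation_mem_Gm (m : ℕ) (n : ℤ) :
    ∃ g ∈ Gm m, ∀ x, g x = x + n * (2 * m - 2) := by
  have h : Equiv.subLeft (2 * (m : ℤ) - 1) * Equiv.subLeft (1 : ℤ) ∈ Gm m :=
    mul_mem (Subgroup.subset_closure (by simp)) (Subgroup.subset_closure (by simp))
  induction n with
  | zero => exact ⟨1, one_mem _, fun x => by simp⟩
  | succ n ih =>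
    obtain ⟨g, hg, hx⟩ := ih
    refine ⟨_, mul_mem hg h, fun x => ?_⟩
    simp [hx]
    ring
  | pred n ih =>
    obtain ⟨g, hg, hx⟩ := ih
    refine ⟨_, mul_mem hg (inv_mem h), fun x => ?_⟩
    have hy : (Equiv.subLeft (2 * (m : ℤ) - 1) * Equiv.subLeft (1 : ℤ))⁻¹ x
        = x - (2 * m - 2) := by
      rw [Equiv.Perm.inv_eq_iff_eq]
      simp
      ring
    rw [Equiv.Perm.mul_apply, hy, hx]
    ring

namespace IsLPP

variable {m k : ℕ} {S T : Set ℤ} {f g : ℤ → ℤ}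

theorem injOn (hf : IsLPP m k S f) : Set.InjOn f S := by
  intro x hx y hy hxy
  obtain ⟨g, hg, rfl⟩ := hf.inj x hx y hy ⟨1, one_mem _, hxy⟩
  rw [hf.equivariant g hg x hx] at hxy
  exact (Gm_apply_eq_self hg hxy.symm x).symm

theorem congr (hf : IsLPP m k S f) (h : Set.EqOn f g S) : IsLPP m k S g where
  invariant := hf.invariant
  equivariant γ hγ x hx := by
    rw [← h hx, ← h (hf.invariant γ hγ x hx), hf.equivariant γ hγ x hx]
  orbits := hf.orbits
  inj x hx y hy := by
    rw [← h hx, ← h hy]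
    exact hf.inj x hx y hy

theorem comp (hf : IsLPP m k S f) (hg : IsLPP m k T g) (hT : Set.MapsTo f S T) :
    IsLPP m k S (g ∘ f) where
  invariant := hf.invariant
  equivariant γ hγ x hx := by
    simp only [Function.comp_apply]
    rw [hf.equivariant γ hγ x hx, hg.equivariant γ hγ _ (hT hx)]
  orbits := hf.orbits
  inj x hx y hy h := hf.inj x hx y hy (hg.inj _ (hT hx) _ (hT hy) h)

theorem exists_abs_sub_le (hf : IsLPP m k S f) (hm : 2 ≤ m) :
    ∃ B : ℤ, ∀ x ∈ S, |f x - x| ≤ B := by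
  obtain ⟨B, hB⟩ := ((Set.finite_Ico (0 : ℤ) (2 * m - 2)).image fun x => |f x - x|).bddAbove
  refine ⟨B, fun x hx => ?_⟩
  have hd : (0 : ℤ) < 2 * m - 2 := by omega
  obtain ⟨γ, hγ, hγx⟩ := exists_translation_mem_Gm m (-(x / (2 * m - 2)))
  have hmod : γ x = x % (2 * m - 2) := by
    rw [hγx, Int.emod_def]
    ring
  have h := hB (Set.mem_image_of_mem _
    ⟨Int.emod_nonneg x hd.ne', Int.emod_lt_of_pos x hd⟩)
  rw [← hmod, hf.equivariant γ hγ x hx, hγx, hγx] at h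
  simpa using h

theorem finite_weightSet (hf : IsLPP m k S f) (hm : 2 ≤ m) (j : ℤ) :
    (weightSet j S f).Finite := by
  obtain ⟨B, hB⟩ := hf.exists_abs_sub_le hm
  refine (Set.finite_Icc (j - B - 1) (j + B + 1)).subset ?_
  rintro i ⟨hi, h⟩
  have hb := abs_le.1 (hB i hi)
  have hb₁ : (-B : ℚ) ≤ f i - i := by exact_mod_cast hb.1
  have hb₂ : (f i - i : ℚ) ≤ B := by exact_mod_cast hb.2
  constructor
  · have : ((j - B - 1 : ℤ) : ℚ) ≤ i := by
      push_cast
      rcases h with h | h <;> linarith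
    exact_mod_cast this
  · have : (i : ℚ) ≤ (j + B + 1 : ℤ) := by
      push_cast
      rcases h with h | h <;> linarith
    exact_mod_cast this

end IsLPP

theorem pairOrbit_apply {m : ℕ} {γ : Equiv.Perm ℤ} (hγ : γ ∈ Gm m) (i j : ℤ) :
    pairOrbit m (γ i, γ j) = pairOrbit m (i, j) := by
  ext A
  constructor
  · rintro ⟨g, hg, rfl⟩
    exact ⟨g * γ, mul_mem hg hγ, rfl⟩
  · rintro ⟨g, hg, rfl⟩
    exact ⟨g * γ⁻¹, mul_mem hg (inv_mem hγ), by simp⟩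

theorem crossings_congr {m : ℕ} {S : Set ℤ} {f g : ℤ → ℤ} (h : Set.EqOn f g S) :
    crossings m S f = crossings m S g := by
  unfold crossings IsCrossing
  congr 1
  ext ⟨i, j⟩
  simp only [Set.mem_ofPred_eq]
  constructor <;> rintro ⟨hi, hj, hij, hf⟩
  · exact ⟨hi, hj, hij, by rwa [← h hi, ← h hj]⟩
  · exact ⟨hi, hj, hij, by rwa [h hi, h hj]⟩

theorem weightSet_congr {j : ℤ} {S : Set ℤ} {f g : ℤ → ℤ} (h : Set.EqOn f g S) :
    weightSet j S f = weightSet j S g := by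
  ext i
  refine and_congr_right fun hi => ?_
  rw [h hi]

namespace IsLPP

variable {m k : ℕ} {S : Set ℤ} {f g : ℤ → ℤ}

theorem finite_crossings (hf : IsLPP m k S f) (hm : 2 ≤ m) : (crossings m S f).Finite := by
  obtain ⟨B, hB⟩ := hf.exists_abs_sub_le hm
  have hd : (0 : ℤ) < 2 * m - 2 := by omega
  refine (((Set.finite_Icc (0 : ℤ) (2 * m - 2)).prod
    (Set.finite_Icc (0 : ℤ) (2 * m - 2 + 2 * B))).image (pairOrbit m)).subset ?_
  rintro _ ⟨⟨i, j⟩, ⟨hi, hj, hij, hlt⟩, rfl⟩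
  dsimp only at hi hj hij hlt
  obtain ⟨γ, hγ, hγx⟩ := exists_translation_mem_Gm m (-(i / (2 * m - 2)))
  have hmod : γ i = i % (2 * m - 2) := by
    rw [hγx, Int.emod_def]
    ring
  refine ⟨(γ i, γ j), ?_, pairOrbit_apply hγ i j⟩
  have h₀ := Int.emod_nonneg i hd.ne'
  have h₁ := Int.emod_lt_of_pos i hd
  have hbi := abs_le.1 (hB i hi)
  have hbj := abs_le.1 (hB j hj)
  have hsub : γ j - γ i = j - i := by
    rw [hγx, hγx]
    ring
  simp only [Set.mem_prod, Set.mem_Icc]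
  omega

theorem image_pairOrbit (hf : IsLPP m k S f) {i j : ℤ} (hi : i ∈ S) (hj : j ∈ S) :
    Set.image f '' pairOrbit m (i, j) = pairOrbit m (f i, f j) := by
  ext A
  constructor
  · rintro ⟨_, ⟨γ, hγ, rfl⟩, rfl⟩
    exact ⟨γ, hγ, by
      simp [Set.image_pair, hf.equivariant γ hγ i hi, hf.equivariant γ hγ j hj]⟩
  · rintro ⟨γ, hγ, rfl⟩
    exact ⟨_, ⟨γ, hγ, rfl⟩, by
      simp [Set.image_pair, hf.equivariant γ hγ i hi, hf.equivariant γ hγ j hj]⟩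

theorem crossings_subset_powerset (hf : IsLPP m k S f) : crossings m S g ⊆ 𝒫 𝒫 S := by
  rintro _ ⟨⟨i, j⟩, ⟨hi, hj, -, -⟩, rfl⟩ _ ⟨γ, hγ, rfl⟩ x (rfl | rfl)
  · exact hf.invariant γ hγ i hi
  · exact hf.invariant γ hγ j hj

theorem injOn_image_image (hf : IsLPP m k S f) :
    Set.InjOn (Set.image (Set.image f)) (𝒫 𝒫 S) :=
  hf.injOn.image.image

/-- Crossing numbers are subadditive under composition. -/
theorem crossCount_comp_le (hf : IsLPP m k S f) (hg : IsLPP m k (f '' S) g) (hm : 2 ≤ m) :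
    crossCount m S (g ∘ f) ≤ crossCount m S f + crossCount m (f '' S) g := by
  unfold crossCount
  have hmaps : Set.MapsTo (Set.image (Set.image f))
      (crossings m S (g ∘ f) \ crossings m S f) (crossings m (f '' S) g) := by
    rintro _ ⟨⟨⟨i, j⟩, ⟨hi, hj, hij, hlt⟩, rfl⟩, hnot⟩
    dsimp only at hi hj hij hlt
    refine ⟨(f i, f j), ⟨Set.mem_image_of_mem f hi, Set.mem_image_of_mem f hj, ?_, hlt⟩,
      (hf.image_pairOrbit hi hj).symm⟩
    refine lt_of_le_of_ne ?_ fun h => hij.ne (hf.injOn hi hj h)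
    exact not_lt.1 fun h => hnot ⟨(i, j), ⟨hi, hj, hij, h⟩, rfl⟩
  calc (crossings m S (g ∘ f)).ncard
      ≤ (crossings m S (g ∘ f) \ crossings m S f).ncard + (crossings m S f).ncard :=
        Set.ncard_le_ncard_sdiff_add_ncard _ _ (hf.finite_crossings hm)
    _ ≤ (crossings m (f '' S) g).ncard + (crossings m S f).ncard := by
        refine Nat.add_le_add_right (Set.ncard_le_ncard_of_injOn _ hmaps ?_
          (hg.finite_crossings hm)) _
        exact hf.injOn_image_image.mono (Set.sdiff_subset.trans hf.crossings_subset_powerset)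
    _ = _ := add_comm _ _

/-- The exponents `w_l(f) + w_l(g) - w_l(g ∘ f)` are natural numbers. -/
theorem two_mul_expMul_add (hf : IsLPP m k S f) (hg : IsLPP m k (f '' S) g) (hm : 2 ≤ m)
    (l : Fin m) :
    2 * expMul m S (f '' S) f g l + (weightSet (((l : ℕ) : ℤ) + 1) S (g ∘ f)).ncard
      = (weightSet (((l : ℕ) : ℤ) + 1) S f).ncard
        + (weightSet (((l : ℕ) : ℤ) + 1) (f '' S) g).ncard := by
  simp only [expMul, Finsupp.equivFunOnFinite_symm_apply_apply]
  set j : ℤ := ((l : ℕ) : ℤ) + 1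
  set B : Set ℤ := {i | i ∈ S ∧ f i ∈ weightSet j (f '' S) g} with hBdef
  have hBS : B ⊆ S := fun i hi => hi.1
  have himage : f '' B = weightSet j (f '' S) g := by
    ext y
    constructor
    · rintro ⟨i, hi, rfl⟩
      exact hi.2
    · intro hy
      obtain ⟨i, hi, rfl⟩ := hy.1
      exact ⟨i, ⟨hi, hy⟩, rfl⟩
  have hcardB : (weightSet j (f '' S) g).ncard = B.ncard := by
    rw [← himage, (hf.injOn.mono hBS).ncard_image]
  have hA := hf.finite_weightSet hm j
  have hB : B.Finite := Set.Finite.of_finite_image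
    (himage ▸ hg.finite_weightSet hm j) (hf.injOn.mono hBS)
  have hne : ∀ n : ℤ, (n : ℚ) ≠ (j : ℚ) - 1 / 2 := by
    intro n h
    have h' : 2 * n = 2 * j - 1 := by
      have : (2 * n : ℚ) = 2 * j - 1 := by linarith
      exact_mod_cast this
    omega
  have hC : weightSet j S (g ∘ f) = (weightSet j S f \ B) ∪ (B \ weightSet j S f) := by
    ext i
    have h₁ := hne i
    have h₂ := hne (f i)
    have h₃ := hne (g (f i))
    simp only [hBdef, weightSet, Set.mem_union, Set.mem_sdiff, Set.mem_ofPred_eq,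
      Function.comp_apply]
    by_cases hi : i ∈ S
    · have hfi := Set.mem_image_of_mem f hi
      rcases h₁.lt_or_gt with a | a <;> rcases h₂.lt_or_gt with b | b <;>
        rcases h₃.lt_or_gt with c | c <;>
        simp only [hi, hfi, a, b, c, a.not_gt, b.not_gt, c.not_gt] <;> simp
    · simp [hi]
  have hdisj : Disjoint (weightSet j S f \ B) (B \ weightSet j S f) :=
    Set.disjoint_left.2 fun _ h h' => h.2 h'.1
  rw [hcardB, hC, Set.ncard_union_eq hdisj hA.sdiff hB.sdiff]
  have h₁ := Set.ncard_inter_add_ncard_sdiff_eq_ncard (weightSet j S f) B hA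
  have h₂ := Set.ncard_inter_add_ncard_sdiff_eq_ncard B (weightSet j S f) hB
  rw [Set.inter_comm] at h₂
  omega

end IsLPP

theorem expMul_congr_left {m : ℕ} {S T : Set ℤ} {f f' g : ℤ → ℤ} (h : Set.EqOn f f' S) :
    expMul m S T f g = expMul m S T f' g := by
  have hc : Set.EqOn (g ∘ f) (g ∘ f') S := fun x hx => congrArg g (h hx)
  simp only [expMul, weightSet_congr h, weightSet_congr hc]

theorem expMul_congr_right {m : ℕ} {S T : Set ℤ} {f g g' : ℤ → ℤ} (h : Set.EqOn g g' T)
    (hT : Set.MapsTo f S T) : expMul m S T f g = expMul m S T f g' := by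
  have hc : Set.EqOn (g ∘ f) (g' ∘ f) S := fun x hx => h (hT hx)
  simp only [expMul, weightSet_congr h, weightSet_congr hc]

/-- The composite of two composable basis elements of the pong algebra. -/
def PongIdx.comp {m k : ℕ} (p q : PongIdx m k) (h : q.1.1 = p.1.2 '' p.1.1) : PongIdx m k :=
  ⟨(p.1.1, fun x => if x ∈ p.1.1 then q.1.2 (p.1.2 x) else x),
    (p.2.1.comp q.2.1 (h ▸ Set.mapsTo_image _ _)).congr fun x hx => by
      simp only [Function.comp_apply, if_pos hx],
    fun x hx => if_neg hx⟩

theorem PongIdx.eqOn_comp {m k : ℕ} (p q : PongIdx m k) (h : q.1.1 = p.1.2 '' p.1.1) :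
    Set.EqOn (p.comp q h).1.2 (q.1.2 ∘ p.1.2) p.1.1 :=
  fun _ hx => if_pos hx

theorem PongIdx.eq_comp {m k : ℕ} {p q t : PongIdx m k} (h : q.1.1 = p.1.2 '' p.1.1)
    (hS : t.1.1 = p.1.1) (ht : Set.EqOn t.1.2 (q.1.2 ∘ p.1.2) p.1.1) : t = p.comp q h := by
  refine Subtype.ext (Prod.ext hS (funext fun x => ?_))
  by_cases hx : x ∈ p.1.1
  · rw [ht hx, p.eqOn_comp q h hx]
  · rw [t.2.2 x (hS ▸ hx), (p.comp q h).2.2 x hx]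

theorem Mmul_eq_zero_of_ne {m k : ℕ} {p q : PongIdx m k} (h : q.1.1 ≠ p.1.2 '' p.1.1)
    (s : PongIdx m k) : Mmul m k p q s = 0 :=
  if_neg fun h' => h h'.1

theorem Mmul_eq_zero_of_dom_ne {m k : ℕ} {p q s : PongIdx m k} (h : s.1.1 ≠ p.1.1) :
    Mmul m k p q s = 0 :=
  if_neg fun h' => h h'.2.2.1

theorem Mmul_eq_zero_of_ne_comp {m k : ℕ} {p q t : PongIdx m k} (h : q.1.1 = p.1.2 '' p.1.1)
    (ht : t ≠ p.comp q h) : Mmul m k p q t = 0 :=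
  if_neg fun h' => ht (PongIdx.eq_comp h h'.2.2.1 h'.2.2.2)

/-- The product of the pong algebra is associative:
`μ₂(μ₂(a, b), c) = μ₂(a, μ₂(b, c))`.  Since `P(m, k)` is the free
`F₂[v₁, …, v_m]`-module on the set of lifted partial permutations and `μ₂` is
bilinear with structure constants `Mmul`, this says exactly that the matrix
coefficients of the two triple products agree. -/
theorem pong_mul_assoc (m k : ℕ) (hm : 2 ≤ m) (hk0 : 0 < k) (hkm : k < m) :
    ∀ p q r s : PongIdx m k,
      ∑ᶠ t : PongIdx m k, Mmul m k p q t * Mmul m k t r s =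
        ∑ᶠ t : PongIdx m k, Mmul m k q r t * Mmul m k p t s := by
  intro p q r s
  by_cases hT : q.1.1 = p.1.2 '' p.1.1
  swap
  · rw [finsum_eq_zero_of_forall_eq_zero, finsum_eq_zero_of_forall_eq_zero]
    · intro t
      by_cases ht : t.1.1 = q.1.1
      · rw [Mmul_eq_zero_of_ne (p := p) (q := t) (ht ▸ hT), mul_zero]
      · rw [Mmul_eq_zero_of_dom_ne ht, zero_mul]
    · intro t
      rw [Mmul_eq_zero_of_ne hT, zero_mul]
  have hqp : (p.comp q hT).1.2 '' p.1.1 = q.1.2 '' q.1.1 := by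
    rw [(p.eqOn_comp q hT).image_eq, Set.image_comp, hT]
  by_cases hU : r.1.1 = q.1.2 '' q.1.1
  swap
  · rw [finsum_eq_zero_of_forall_eq_zero, finsum_eq_zero_of_forall_eq_zero]
    · intro t
      rw [Mmul_eq_zero_of_ne hU, zero_mul]
    · intro t
      by_cases ht : t = p.comp q hT
      · have : r.1.1 ≠ t.1.2 '' t.1.1 := by
          rw [ht]
          exact fun h => hU (h.trans hqp)
        rw [Mmul_eq_zero_of_ne this, mul_zero]
      · rw [Mmul_eq_zero_of_ne_comp hT ht, zero_mul]
  rw [finsum_eq_single _ (p.comp q hT) fun t ht => by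
      rw [Mmul_eq_zero_of_ne_comp hT ht, zero_mul],
    finsum_eq_single _ (q.comp r hU) fun t ht => by
      rw [Mmul_eq_zero_of_ne_comp hU ht, zero_mul]]
  have hpqS : (p.comp q hT).1.1 = p.1.1 := rfl
  have hqrS : (q.comp r hU).1.1 = q.1.1 := rfl
  have epq := p.eqOn_comp q hT
  have eqr := q.eqOn_comp r hU
  generalize p.comp q hT = pq at *
  generalize q.comp r hU = qr at *
  have hf := p.2.1
  have hg := q.2.1
  have hh := r.2.1
  have hgf := pq.2.1
  have hhg := qr.2.1
  simp only [Mmul]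
  generalize p.1.1 = S, p.1.2 = f, q.1.1 = T, q.1.2 = g, r.1.1 = U, r.1.2 = h, s.1.1 = V,
    s.1.2 = e, pq.1.1 = S', pq.1.2 = gf, qr.1.1 = T', qr.1.2 = hg' at *
  subst hpqS hqrS hT
  have hmaps : Set.MapsTo f S' (f '' S') := Set.mapsTo_image f S'
  have hUc : U = (g ∘ f) '' S' := by rw [hU, Set.image_comp]
  have e₁ : Set.EqOn (h ∘ gf) (h ∘ g ∘ f) S' := fun x hx => congrArg h (epq hx)
  have e₂ : Set.EqOn (hg' ∘ f) (h ∘ g ∘ f) S' := fun x hx => eqr (hmaps hx)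
  have hgf' := hgf.congr epq
  have hhg' := hhg.congr eqr
  have hle₁ := hf.crossCount_comp_le hg hm
  have hle₂ := hg.crossCount_comp_le (hU ▸ hh) hm
  rw [← hU] at hle₂
  have hexp : expMul m S' (f '' S') f g + expMul m S' U (g ∘ f) h
      = expMul m (f '' S') U g h + expMul m S' (f '' S') f (h ∘ g) := by
    ext l
    have w₁ := hf.two_mul_expMul_add hg hm l
    have w₂ := hgf'.two_mul_expMul_add (hUc ▸ hh) hm l
    have w₃ := hg.two_mul_expMul_add (hU ▸ hh) hm l
    have w₄ := hf.two_mul_expMul_add hhg' hm l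
    rw [← hUc] at w₂
    rw [← hU] at w₃
    rw [Function.comp_assoc] at w₄
    simp only [Finsupp.add_apply]
    omega
  have hS₁ : Set.EqOn e (h ∘ gf) S' ↔ Set.EqOn e (h ∘ g ∘ f) S' :=
    ⟨fun H => H.trans e₁, fun H => H.trans e₁.symm⟩
  have hS₂ : Set.EqOn e (hg' ∘ f) S' ↔ Set.EqOn e (h ∘ g ∘ f) S' :=
    ⟨fun H => H.trans e₂, fun H => H.trans e₂.symm⟩
  have c₁ : crossCount m S' gf = crossCount m S' (g ∘ f) :=
    congrArg Set.ncard (crossings_congr epq)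
  have c₂ : crossCount m (f '' S') hg' = crossCount m (f '' S') (h ∘ g) :=
    congrArg Set.ncard (crossings_congr eqr)
  have c₃ : crossCount m S' (h ∘ gf) = crossCount m S' (h ∘ g ∘ f) :=
    congrArg Set.ncard (crossings_congr e₁)
  have c₄ : crossCount m S' (hg' ∘ f) = crossCount m S' (h ∘ g ∘ f) :=
    congrArg Set.ncard (crossings_congr e₂)
  have hle₃ := hgf'.crossCount_comp_le (hUc ▸ hh) hm
  have hle₄ := hf.crossCount_comp_le hhg' hm
  rw [← hUc] at hle₃
  rw [Function.comp_assoc] at hle₄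
  simp only [c₁, c₂, c₃, c₄, hS₁, hS₂, expMul_congr_left epq,
    expMul_congr_right eqr hmaps, hqp, ← hU, epq, eqr, true_and, and_true,
    ite_zero_mul_ite_zero, MvPolynomial.monomial_mul, one_mul, hexp]
  refine if_congr ?_ rfl rfl
  constructor
  · rintro ⟨h₁, h₂, h₃⟩
    exact ⟨by omega, by omega, h₃⟩
  · rintro ⟨h₁, h₂, h₃⟩
    exact ⟨by omega, by omega, h₃⟩
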